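/- Let d ≥ 2, k > 0, let Q := (0,k)^d ⊂ ℝ^d, let a : ℝ → [0, +∞) be Borel measurable and integrable on (0,k), and let ξ = (ξ₁, …, ξ_d) ∈ ℝ^d. Then for every continuously differentiable function u : ℝ^d → ℝ with compact support contained in Q, ∫_Q a(x₁) |∇u(x) + ξ| dx ≥ |(ξ₂, …, ξ_d)| · k^{d−1} · ∫₀^k a(x₁) dx₁, where |·| denotes the Euclidean norm and x₁ is the first coordinate of x. -/

import Mathlib

open MeasureTheory Set

/-- On a cube `S^d`, the first-coordinate projection (or any other one) pushes Lebesgue measure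
to a multiple of Lebesgue measure on `S`. -/
theorem map_coord_restrict_cube {d : ℕ} (j : Fin d) (S : Set ℝ)
    (hS : MeasurableSet S) (hS' : volume S ≠ ⊤) :
    ((volume : Measure (EuclideanSpace ℝ (Fin d))).restrict {x | ∀ i, x i ∈ S}).map
      (fun x => x j) = (volume S) ^ (d - 1) • volume.restrict S := by
  have : IsFiniteMeasure ((volume : Measure ℝ).restrict S) :=
    ⟨by simpa using hS'.lt_top⟩
  have hmp := EuclideanSpace.volume_preserving_symm_measurableEquiv_toLp (Fin d)
  have hpi : MeasurableSet (univ.pi fun _ : Fin d => S) := .univ_pi fun _ => hS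
  have hr := hmp.restrict_preimage hpi
  have hset : (MeasurableEquiv.toLp 2 (Fin d → ℝ)).symm ⁻¹' (univ.pi fun _ : Fin d => S)
      = {x : EuclideanSpace ℝ (Fin d) | ∀ i, x i ∈ S} := by
    ext x; simp
  rw [hset, volume_pi, Measure.restrict_pi_pi] at hr
  have hcomp : (fun x : EuclideanSpace ℝ (Fin d) => x j)
      = Function.eval j ∘ (MeasurableEquiv.toLp 2 (Fin d → ℝ)).symm := rfl
  rw [hcomp, ← Measure.map_map (measurable_pi_apply j) (MeasurableEquiv.measurable _), hr.map_eq,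
    Measure.pi_map_eval]
  simp

theorem integrableOn_coord_cube {d : ℕ} (j : Fin d) {S : Set ℝ} (hS : MeasurableSet S)
    (hS' : volume S ≠ ⊤) {f : ℝ → ℝ} (hf : IntegrableOn f S) :
    IntegrableOn (fun x : EuclideanSpace ℝ (Fin d) => f (x j)) {x | ∀ i, x i ∈ S} := by
  have h : Integrable f
      (((volume : Measure (EuclideanSpace ℝ (Fin d))).restrict {x | ∀ i, x i ∈ S}).map
        fun x => x j) := by
    rw [map_coord_restrict_cube j S hS hS']
    exact hf.smul_measure (ENNReal.pow_ne_top hS')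
  exact h.comp_measurable (by fun_prop)

theorem setIntegral_coord_cube {d : ℕ} (j : Fin d) {S : Set ℝ} (hS : MeasurableSet S)
    (hS' : volume S ≠ ⊤) {f : ℝ → ℝ} (hf : Measurable f) :
    ∫ x in {x : EuclideanSpace ℝ (Fin d) | ∀ i, x i ∈ S}, f (x j)
      = volume.real S ^ (d - 1) * ∫ t in S, f t := by
  rw [← integral_map (φ := fun x : EuclideanSpace ℝ (Fin d) => x j) (f := f) (by fun_prop)
    hf.aestronglyMeasurable, map_coord_restrict_cube j S hS hS', integral_smul_measure]
  simp [Measure.real]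

theorem locallyIntegrable_comp_coord {d : ℕ} (j : Fin d) {f : ℝ → ℝ}
    (hf : LocallyIntegrable f) :
    LocallyIntegrable fun x : EuclideanSpace ℝ (Fin d) => f (x j) := by
  rw [locallyIntegrable_iff]
  intro K hK
  obtain ⟨R, hR⟩ := hK.isBounded.subset_closedBall 0
  refine (integrableOn_coord_cube j (S := Icc (-R) R) measurableSet_Icc (by simp)
    (hf.integrableOn_isCompact isCompact_Icc)).mono_set fun x hx i => ?_
  have h1 : ‖x‖ ≤ R := by simpa using hR hx
  exact abs_le.1 ((PiLp.norm_apply_le x i).trans h1)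

/-- Integrating a directional derivative against a weight that is invariant in that direction
gives zero. -/
theorem integral_mul_fderiv_eq_zero_of_invariant {E : Type*} [NormedAddCommGroup E]
    [NormedSpace ℝ E] [FiniteDimensional ℝ E] [MeasurableSpace E] [BorelSpace E]
    {μ : Measure E} [μ.IsAddHaarMeasure] {g u : E → ℝ} {v : E}
    (hg : LocallyIntegrable g μ) (hgv : ∀ x (t : ℝ), g (x + t • v) = g x)
    (hu : ContDiff ℝ 1 u) (hu_supp : HasCompactSupport u) :
    ∫ x, g x * fderiv ℝ u x v ∂μ = 0 := by
  have hcd : Continuous (fderiv ℝ u) := hu.continuous_fderiv one_ne_zero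
  obtain ⟨C, hC⟩ := hcd.bounded_above_of_compact_support (hu_supp.fderiv ℝ)
  obtain ⟨R, hR⟩ := hu_supp.isCompact.isBounded.subset_closedBall 0
  set B : Set E := Metric.closedBall 0 (R + ‖v‖)
  have hconst : ∀ t : ℝ, ∫ x, g x * u (x + t • v) ∂μ = ∫ x, g x * u x ∂μ := by
    intro t
    rw [← integral_add_right_eq_self (fun x => g x * u x) (t • v)]
    simp only [hgv]
  have hder : HasDerivAt (fun t : ℝ => ∫ x, g x * u (x + t • v) ∂μ)
      (∫ x, g x * fderiv ℝ u (x + (0 : ℝ) • v) v ∂μ) 0 := by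
    refine (hasDerivAt_integral_of_dominated_loc_of_deriv_le
      (F := fun (t : ℝ) x => g x * u (x + t • v))
      (F' := fun (t : ℝ) x => g x * fderiv ℝ u (x + t • v) v)
      (bound := B.indicator fun x => ‖g x‖ * (C * ‖v‖))
      (Metric.ball_mem_nhds 0 one_pos) ?_ ?_ ?_ ?_ ?_ ?_).2
    · refine .of_forall fun t => hg.aestronglyMeasurable.mul ?_
      exact (hu.continuous.comp (by fun_prop)).aestronglyMeasurable
    · simpa using hg.integrable_smul_right_of_hasCompactSupport hu.continuous hu_supp
    · refine hg.aestronglyMeasurable.mul ?_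
      exact Continuous.aestronglyMeasurable (by fun_prop)
    · refine .of_forall fun x t ht => ?_
      by_cases hx : x ∈ B
      · rw [indicator_of_mem hx, norm_mul]
        gcongr
        exact (ContinuousLinearMap.le_opNorm _ _).trans (by gcongr; exact hC _)
      · rw [indicator_of_notMem hx]
        have h0 : fderiv ℝ u (x + t • v) = 0 := by
          refine image_eq_zero_of_notMem_tsupport fun h => hx ?_
          have h1 : ‖x + t • v‖ ≤ R := by simpa using hR (tsupport_fderiv_subset ℝ h)
          have h2 : ‖t • v‖ ≤ ‖v‖ := by
            rw [norm_smul]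
            exact mul_le_of_le_one_left (norm_nonneg v) (by simpa using (mem_ball_zero_iff.1 ht).le)
          have h3 := norm_sub_le (x + t • v) (t • v)
          rw [add_sub_cancel_right] at h3
          simpa [B] using h3.trans (add_le_add h1 h2)
        simp [h0]
    · exact IntegrableOn.integrable_indicator
        ((hg.integrableOn_isCompact (isCompact_closedBall _ _)).norm.mul_const _)
        Metric.isClosed_closedBall.measurableSet
    · refine .of_forall fun x t _ => HasDerivAt.const_mul _ ?_
      have h1 : HasDerivAt (fun t : ℝ => x + t • v) v t := by
        simpa using ((hasDerivAt_id t).smul_const v).const_add x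
      exact ((hu.differentiable one_ne_zero) _).hasFDerivAt.comp_hasDerivAt t h1
  simp only [hconst] at hder
  simpa using hder.unique (hasDerivAt_const _ _)

/-- (Remark 3.4.) Slicing lower bound: for the cube `Q = (0,k)^d` (`d ≥ 2`), a nonnegative
integrable weight `a` depending only on the first coordinate, and any `C¹` function `u`
with compact support in `Q`,
`∫_Q a(x₁)|∇u(x)+ξ| dx ≥ |(ξ₂,…,ξ_d)| · k^{d−1} · ∫₀^k a(x₁) dx₁`. -/
theorem slicing_lower_bound
    {d : ℕ} (hd : 2 ≤ d) (k : ℝ) (hk : 0 < k)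
    (a : ℝ → ℝ) (ha_meas : Measurable a) (ha_nonneg : ∀ t, 0 ≤ a t)
    (ha_int : IntegrableOn a (Set.Ioo (0:ℝ) k) volume)
    (ξ : EuclideanSpace ℝ (Fin d))
    (u : EuclideanSpace ℝ (Fin d) → ℝ)
    (hu : ContDiff ℝ 1 u) (hu_supp : HasCompactSupport u)
    (hu_sub : tsupport u ⊆ {x : EuclideanSpace ℝ (Fin d) | ∀ i, x i ∈ Set.Ioo (0:ℝ) k}) :
    Real.sqrt (∑ i ∈ Finset.univ.erase (⟨0, by omega⟩ : Fin d), ξ i ^ 2) * k ^ (d - 1) *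
        ∫ t in Set.Ioo (0:ℝ) k, a t
      ≤ ∫ x in {x : EuclideanSpace ℝ (Fin d) | ∀ i, x i ∈ Set.Ioo (0:ℝ) k},
          a (x ⟨0, by omega⟩) * ‖gradient u x + ξ‖ := by
  set j : Fin d := ⟨0, by omega⟩
  set Q : Set (EuclideanSpace ℝ (Fin d)) := {x | ∀ i, x i ∈ Ioo (0 : ℝ) k}
  have hQ : MeasurableSet Q := by
    simp only [Q, ofPred_forall]
    exact .iInter fun i => measurableSet_Ioo.preimage (by fun_prop)
  have haQ : IntegrableOn (fun x : EuclideanSpace ℝ (Fin d) => a (x j)) Q :=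
    integrableOn_coord_cube j measurableSet_Ioo (by simp) ha_int
  have haI : ∫ x in Q, a (x j) = k ^ (d - 1) * ∫ t in Ioo (0 : ℝ) k, a t := by
    rw [setIntegral_coord_cube j measurableSet_Ioo (by simp) ha_meas]
    simp [hk.le]
  have hfd : Continuous (fderiv ℝ u) := hu.continuous_fderiv one_ne_zero
  have hgrad : Continuous (gradient u) :=
    (InnerProductSpace.toDual ℝ (EuclideanSpace ℝ (Fin d))).symm.continuous.comp hfd
  obtain ⟨C, hC⟩ := hfd.bounded_above_of_compact_support (hu_supp.fderiv ℝ)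
  have hgC : ∀ x, ‖gradient u x‖ ≤ C := fun x => by
    simpa [gradient] using hC x
  set L := Real.sqrt (∑ i ∈ Finset.univ.erase j, ξ i ^ 2)
  -- the component of `ξ` orthogonal to the slicing direction
  set w : EuclideanSpace ℝ (Fin d) := WithLp.toLp 2 (Function.update ξ.ofLp j 0)
  have hwj : w j = 0 := by simp [w]
  have hwi : ∀ i, i ≠ j → w i = ξ i := fun i hi => by simp [w, hi]
  have hwn : ‖w‖ = L := by
    rw [EuclideanSpace.norm_eq, ← Finset.add_sum_erase _ _ (Finset.mem_univ j), hwj]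
    simp only [norm_zero, Real.norm_eq_abs, sq_abs]
    rw [Finset.sum_congr rfl fun i hi => by rw [hwi i (Finset.ne_of_mem_erase hi)]]
    simp [L]
  have hwξ : inner ℝ w ξ = L ^ 2 := by
    rw [← hwn, ← real_inner_self_eq_norm_sq, PiLp.inner_apply, PiLp.inner_apply]
    refine Finset.sum_congr rfl fun i _ => ?_
    rcases eq_or_ne i j with rfl | hi
    · simp [hwj]
    · rw [hwi i hi]
  have hL0 : 0 ≤ L := Real.sqrt_nonneg _
  rcases hL0.eq_or_lt with hL | hL
  · rw [← hL]
    simpa using setIntegral_nonneg hQ fun x _ => mul_nonneg (ha_nonneg _) (norm_nonneg _)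
  have hzero : ∫ x in Q, a (x j) * fderiv ℝ u x w = 0 := by
    have hb : LocallyIntegrable ((Ioo (0 : ℝ) k).indicator a) :=
      (ha_int.integrable_indicator measurableSet_Ioo).locallyIntegrable
    have h := integral_mul_fderiv_eq_zero_of_invariant (v := w)
      (locallyIntegrable_comp_coord j hb) (fun x t => by simp [hwj]) hu hu_supp
    rw [← setIntegral_eq_integral_of_forall_compl_eq_zero (s := Q) fun x hx => ?_] at h
    · refine (setIntegral_congr_fun hQ fun x hx => ?_).trans h
      simp only [indicator_of_mem (hx j)]
    · rw [image_eq_zero_of_notMem_tsupport (f := fderiv ℝ u)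
        fun h => hx (hu_sub (tsupport_fderiv_subset ℝ h))]
      simp
  have hi1 : IntegrableOn (fun x => a (x j) * ‖gradient u x + ξ‖) Q := by
    refine Integrable.mul_bdd (c := C + ‖ξ‖) haQ (by fun_prop) (.of_forall fun x => ?_)
    rw [norm_norm]
    exact (norm_add_le _ _).trans (by gcongr; exact hgC x)
  have hi2 : IntegrableOn (fun x => a (x j) * fderiv ℝ u x w) Q := by
    refine Integrable.mul_bdd (c := C * ‖w‖) haQ
      (Continuous.aestronglyMeasurable (by fun_prop)) (.of_forall fun x => ?_)
    exact (ContinuousLinearMap.le_opNorm _ _).trans (by gcongr; exact hC x)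
  have hpt : ∀ x, a (x j) * fderiv ℝ u x w + a (x j) * L ^ 2
      ≤ L * (a (x j) * ‖gradient u x + ξ‖) := fun x => by
    have h1 : fderiv ℝ u x w + L ^ 2 = inner ℝ w (gradient u x + ξ) := by
      rw [inner_add_right, hwξ, real_inner_comm, gradient, InnerProductSpace.toDual_symm_apply]
    have h2 := real_inner_le_norm w (gradient u x + ξ)
    rw [← h1, hwn] at h2
    nlinarith [mul_le_mul_of_nonneg_left h2 (ha_nonneg (x j))]
  have hmono := integral_mono (hi2.add (haQ.mul_const (L ^ 2))) (hi1.const_mul L) hpt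
  simp only [Pi.add_apply] at hmono
  rw [integral_add hi2 (haQ.mul_const _), hzero, integral_mul_const, integral_const_mul, haI]
    at hmono
  refine le_of_mul_le_mul_left ?_ hL
  linarith
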